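/- arXiv:2207.11731 — 2 statements merged into one kernel-verified Lean document; each statement's English description precedes it below -/
import Mathlib

section
/- Let n ≥ 1, i ∈ {1,…,n}, and let a = (a₁,…,a_r) and b = (b₁,…,b_m) be (i,n)-segments with r ≥ m. Then a and b are in special position if and only if there exists j ∈ [1,m] such that one of the following holds: (a) b_j − a_r ∈ S_{i,n} or a₁ − b_j ∈ S_{i,n}; (b) b₁ − a₁ ∈ 2ℤ and there exists k ∈ [1, r−1] with a_k < b_j < a_{k+1}. -/
/-- `S_{i,n} = {2j : 1 ≤ j ≤ min(i, n+1-i)} ⊆ ℤ`. -/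
def Sseg (i n : ℕ) : Set ℤ :=
  {x | ∃ j : ℕ, 1 ≤ j ∧ j ≤ min i (n + 1 - i) ∧ x = 2 * (j : ℤ)}

/-- `(a 1, …, a r)` is an `(i,n)`-segment: consecutive differences lie in `S_{i,n}`. -/
def IsSeg (i n r : ℕ) (a : ℕ → ℤ) : Prop :=
  ∀ p : ℕ, 2 ≤ p → p ≤ r → a p - a (p - 1) ∈ Sseg i n

/-- Two `(i,n)`-segments `(a 1,…,a r)` and `(b 1,…,b s)` are in general position:
there is no `(i,n)`-segment of length `> max r s` all of whose entries lie in the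
union of the entries of `a` and of `b`. -/
def GenPos (i n r : ℕ) (a : ℕ → ℤ) (s : ℕ) (b : ℕ → ℤ) : Prop :=
  ¬ ∃ (t : ℕ) (c : ℕ → ℤ), max r s < t ∧ IsSeg i n t c ∧
      ∀ q : ℕ, 1 ≤ q → q ≤ t →
        ((∃ p : ℕ, 1 ≤ p ∧ p ≤ r ∧ a p = c q) ∨ (∃ p : ℕ, 1 ≤ p ∧ p ≤ s ∧ b p = c q))


theorem mem_S {i n : ℕ} {x : ℤ} :
    x ∈ Sseg i n ↔ 2 ∣ x ∧ 0 < x ∧ x ≤ 2 * ((min i (n + 1 - i) : ℕ) : ℤ) := by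
  generalize hM : min i (n + 1 - i) = M
  simp only [Sseg, Set.mem_setOf_eq, hM]
  constructor
  · rintro ⟨j, h1, h2, rfl⟩
    omega
  · rintro ⟨⟨y, rfl⟩, h1, h2⟩
    exact ⟨y.toNat, by omega, by omega, by omega⟩

theorem seg_step {i n r : ℕ} {a : ℕ → ℤ} (ha : IsSeg i n r a) (p : ℕ) (h1 : 1 ≤ p)
    (h2 : p < r) : a (p + 1) - a p ∈ Sseg i n := by
  have := ha (p + 1) (by omega) (by omega)
  simpa using this

theorem seg_mono {i n r : ℕ} {a : ℕ → ℤ} (ha : IsSeg i n r a) (p : ℕ) (h1 : 1 ≤ p) (d : ℕ) :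
    p + d ≤ r → a p + d ≤ a (p + d) ∧ 2 ∣ a (p + d) - a p := by
  induction d with
  | zero => intro _; simp
  | succ d ih =>
    intro h
    have h3 := ih (by omega)
    have h4 := mem_S.1 (seg_step ha (p + d) (by omega) (by omega))
    rw [← add_assoc]
    push_cast
    omega

theorem seg_lt {i n r : ℕ} {a : ℕ → ℤ} (ha : IsSeg i n r a) (p q : ℕ) (h1 : 1 ≤ p)
    (h : p < q) (h2 : q ≤ r) : a p < a q := by
  obtain ⟨d, rfl⟩ := Nat.exists_eq_add_of_le h.le
  have := seg_mono ha p h1 d h2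
  omega

theorem seg_par {i n r : ℕ} {a : ℕ → ℤ} (ha : IsSeg i n r a) (p : ℕ) (h1 : 1 ≤ p)
    (h2 : p ≤ r) : a 1 ≤ a p ∧ a p ≤ a r ∧ 2 ∣ a p - a 1 := by
  obtain ⟨d, rfl⟩ := Nat.exists_eq_add_of_le h1
  obtain ⟨e, rfl⟩ := Nat.exists_eq_add_of_le h2
  have := seg_mono ha 1 le_rfl d h2
  have := seg_mono ha (1 + d) h1 e le_rfl
  omega

theorem pigeon {i n r t : ℕ} {a c : ℕ → ℤ} (hc : IsSeg i n t c)
    (h : ∀ q, 1 ≤ q → q ≤ t → ∃ p, 1 ≤ p ∧ p ≤ r ∧ a p = c q) : t ≤ r := by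
  have h1 : (Finset.Icc 1 t).image c ⊆ (Finset.Icc 1 r).image a := by
    intro x hx
    simp only [Finset.mem_image, Finset.mem_Icc] at hx ⊢
    obtain ⟨q, ⟨hq1, hq2⟩, rfl⟩ := hx
    obtain ⟨p, hp1, hp2, hp⟩ := h q hq1 hq2
    exact ⟨p, ⟨hp1, hp2⟩, hp⟩
  have h2 : ((Finset.Icc 1 t).image c).card = t := by
    rw [Finset.card_image_of_injOn]
    · simp
    · intro x hx y hy hxy
      simp only [Finset.coe_Icc, Set.mem_Icc] at hx hy
      rcases lt_trichotomy x y with hl | hl | hl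
      · have := seg_lt hc x y hx.1 hl hy.2; omega
      · exact hl
      · have := seg_lt hc y x hy.1 hl hx.2; omega
  have h3 := Finset.card_le_card h1
  have h4 := Finset.card_image_le (s := Finset.Icc 1 r) (f := a)
  simp only [Nat.card_Icc] at h4
  omega

theorem locate (a : ℕ → ℤ) (x : ℤ) (h1 : a 1 ≤ x) (r : ℕ) (hr : 1 ≤ r) : x ≤ a r →
    (∃ k, 1 ≤ k ∧ k ≤ r ∧ a k = x) ∨ ∃ k, 1 ≤ k ∧ k < r ∧ a k < x ∧ x < a (k + 1) := by
  induction r, hr using Nat.le_induction with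
  | base => intro h; exact Or.inl ⟨1, le_rfl, le_rfl, by omega⟩
  | succ r hr ih =>
    intro h
    by_cases h2 : x ≤ a r
    · rcases ih h2 with ⟨k, hk1, hk2, hk3⟩ | ⟨k, hk1, hk2, hk3⟩
      · exact Or.inl ⟨k, hk1, by omega, hk3⟩
      · exact Or.inr ⟨k, hk1, by omega, hk3⟩
    · by_cases h3 : x = a (r + 1)
      · exact Or.inl ⟨r + 1, by omega, le_rfl, h3.symm⟩
      · exact Or.inr ⟨r, hr, by omega, by omega, by omega⟩

theorem far_case {i n r m t : ℕ} {a b c : ℕ → ℤ} (hc : IsSeg i n t c) (hrm : m ≤ r) (ht : 1 ≤ t)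
    (hu : ∀ q : ℕ, 1 ≤ q → q ≤ t →
        ((∃ p : ℕ, 1 ≤ p ∧ p ≤ r ∧ a p = c q) ∨ (∃ p : ℕ, 1 ≤ p ∧ p ≤ m ∧ b p = c q)))
    (hf : ∀ p q, 1 ≤ p → p ≤ r → 1 ≤ q → q ≤ m →
      b q - a p ∉ Sseg i n ∧ a p - b q ∉ Sseg i n) : t ≤ r := by
  rcases hu 1 le_rfl ht with h | h
  · refine pigeon (a := a) hc fun q hq => ?_
    induction q, hq using Nat.le_induction with
    | base => intro _; exact h
    | succ q hq ih =>
      intro hqt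
      obtain ⟨p, hp1, hp2, hp⟩ := ih (by omega)
      rcases hu (q + 1) (by omega) hqt with h' | ⟨s, hs1, hs2, hs⟩
      · exact h'
      · have := seg_step hc q hq (by omega)
        rw [← hp, ← hs] at this
        exact absurd this (hf p s hp1 hp2 hs1 hs2).1
  · refine le_trans (pigeon (a := b) (r := m) hc fun q hq => ?_) hrm
    induction q, hq using Nat.le_induction with
    | base => intro _; exact h
    | succ q hq ih =>
      intro hqt
      obtain ⟨p, hp1, hp2, hp⟩ := ih (by omega)
      rcases hu (q + 1) (by omega) hqt with ⟨s, hs1, hs2, hs⟩ | h'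
      · have := seg_step hc q hq (by omega)
        rw [← hp, ← hs] at this
        exact absurd this (hf s p hs1 hs2 hp1 hp2).2
      · exact h'

/-- Inserting `x` after position `k`. -/
theorem insert_case {i n r m k j : ℕ} {a b : ℕ → ℤ} (ha : IsSeg i n r a) (hrm : m ≤ r)
    (hj1 : 1 ≤ j) (hj2 : j ≤ m) (hk : k ≤ r)
    (h1 : 1 ≤ k → b j - a k ∈ Sseg i n) (h2 : k < r → a (k + 1) - b j ∈ Sseg i n) :
    ¬ GenPos i n r a m b := by
  unfold GenPos
  rw [not_not]
  refine ⟨r + 1, fun p => if p ≤ k then a p else if p = k + 1 then b j else a (p - 1),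
    by omega, ?_, ?_⟩
  · intro p hp1 hp2
    dsimp only
    rcases lt_trichotomy p (k + 1) with h | h | h
    · rw [if_pos (by omega), if_pos (by omega)]
      exact ha p hp1 (by omega)
    · subst h
      rw [if_neg (by omega), if_pos rfl, if_pos (by omega)]
      exact h1 (by omega)
    · rw [if_neg (by omega), if_neg (by omega), if_neg (by omega)]
      by_cases h' : p = k + 2
      · subst h'
        rw [if_pos (by omega)]
        exact h2 (by omega)
      · rw [if_neg (by omega)]
        exact ha (p - 1) (by omega) (by omega)
  · intro q hq1 hq2
    dsimp only
    rcases lt_trichotomy q (k + 1) with h | h | h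
    · rw [if_pos (by omega)]
      exact Or.inl ⟨q, hq1, by omega, rfl⟩
    · rw [if_neg (by omega), if_pos h]
      exact Or.inr ⟨j, hj1, hj2, rfl⟩
    · rw [if_neg (by omega), if_neg (by omega)]
      exact Or.inl ⟨q - 1, by omega, by omega, rfl⟩

theorem stmt2 (n i : ℕ) (hn : 1 ≤ n) (hi1 : 1 ≤ i) (hi2 : i ≤ n)
    (r m : ℕ) (hm : 1 ≤ m) (hrm : m ≤ r)
    (a b : ℕ → ℤ) (ha : IsSeg i n r a) (hb : IsSeg i n m b) :
    ¬ GenPos i n r a m b ↔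
      ∃ j : ℕ, 1 ≤ j ∧ j ≤ m ∧
        ((b j - a r ∈ Sseg i n ∨ a 1 - b j ∈ Sseg i n) ∨
         ((2 : ℤ) ∣ (b 1 - a 1) ∧
           ∃ k : ℕ, 1 ≤ k ∧ k < r ∧ a k < b j ∧ b j < a (k + 1))) := by
  constructor
  · intro hG
    unfold GenPos at hG
    rw [not_not] at hG
    obtain ⟨t, c, ht, hc, hu⟩ := hG
    by_contra hcon
    have hr : 1 ≤ r := by omega
    have key : ∀ j, 1 ≤ j → j ≤ m → b j - a r ∉ Sseg i n ∧ a 1 - b j ∉ Sseg i n := by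
      intro j h1 h2
      exact ⟨fun h => hcon ⟨j, h1, h2, Or.inl (Or.inl h)⟩,
        fun h => hcon ⟨j, h1, h2, Or.inl (Or.inr h)⟩⟩
    have hlt : r < t := lt_of_le_of_lt (le_max_left _ _) ht
    by_cases hpar : (2 : ℤ) ∣ b 1 - a 1
    · have key2 : ∀ j, 1 ≤ j → j ≤ m → ¬ ∃ k : ℕ, 1 ≤ k ∧ k < r ∧ a k < b j ∧ b j < a (k + 1) :=
        fun j h1 h2 h => hcon ⟨j, h1, h2, Or.inr ⟨hpar, h⟩⟩
      have har := seg_par ha r hr le_rfl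
      have hup : ∀ j, 1 ≤ j → j ≤ m → (a r < b j ↔ a r < b 1) := by
        intro j hj
        induction j, hj using Nat.le_induction with
        | base => intro _; rfl
        | succ j hj ih =>
          intro hjm
          rw [← ih (by omega)]
          have h1 := mem_S.1 (seg_step hb j hj (by omega))
          have h2 := (key (j + 1) (by omega) hjm).1
          have h3 := seg_par hb (j + 1) (by omega) hjm
          rw [mem_S] at h2
          generalize ((min i (n + 1 - i) : ℕ) : ℤ) = M at *
          omega
      have hdn : ∀ j, 1 ≤ j → j ≤ m → (b j < a 1 ↔ b 1 < a 1) := by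
        intro j hj
        induction j, hj using Nat.le_induction with
        | base => intro _; rfl
        | succ j hj ih =>
          intro hjm
          rw [← ih (by omega)]
          have h1 := mem_S.1 (seg_step hb j hj (by omega))
          have h2 := (key j (by omega) (by omega)).2
          have h3 := seg_par hb j (by omega) (by omega)
          rw [mem_S] at h2
          generalize ((min i (n + 1 - i) : ℕ) : ℤ) = M at *
          omega
      by_cases hfar : a r < b 1 ∨ b 1 < a 1
      · have := far_case hc hrm (by omega) hu (by
          intro p q hp1 hp2 hq1 hq2
          have h1 := hup q hq1 hq2
          have h2 := hdn q hq1 hq2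
          have h3 := key q hq1 hq2
          have h4 := seg_par ha p hp1 hp2
          have h5 := seg_par hb q hq1 hq2
          simp only [mem_S] at h3 ⊢
          generalize ((min i (n + 1 - i) : ℕ) : ℤ) = M at *
          omega)
        omega
      · have : t ≤ r := by
          refine pigeon (a := a) hc fun q hq1 hq2 => ?_
          rcases hu q hq1 hq2 with h | ⟨p, hp1, hp2, hp⟩
          · exact h
          · have h1 := hup p hp1 hp2
            have h2 := hdn p hp1 hp2
            rcases locate a (b p) (by omega) r hr (by omega) with h | h
            · rw [← hp]; exact h
            · exact absurd h (key2 p hp1 hp2)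
        omega
    · have := far_case hc hrm (by omega) hu (by
        intro p q hp1 hp2 hq1 hq2
        have h4 := seg_par ha p hp1 hp2
        have h5 := seg_par hb q hq1 hq2
        simp only [mem_S]
        omega)
      omega
  · rintro ⟨j, hj1, hj2, (h | h) | ⟨hpar, k, hk1, hk2, hk3, hk4⟩⟩
    · exact insert_case ha hrm hj1 hj2 le_rfl (fun _ => h) (fun h => by omega)
    · exact insert_case (k := 0) ha hrm hj1 hj2 (by omega) (fun h => by omega) (fun _ => h)
    · have h1 := mem_S.1 (seg_step ha k hk1 hk2)
      have h2 := seg_par hb j hj1 hj2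
      have h3 := seg_par ha k hk1 hk2.le
      refine insert_case (k := k) ha hrm hj1 hj2 hk2.le (fun _ => ?_) (fun _ => ?_) <;>
      · rw [mem_S]
        generalize ((min i (n + 1 - i) : ℕ) : ℤ) = M at *
        omega
end

section
/- Let i, ī, n be positive integers with n+1 = i(ī+1). Let k ≥ 1 and for each s ∈ [1,k] let j_s ∈ [1,ī] and a_s ∈ ℤ with a_s ≤ 0 and j_s − a_s ∈ 2ℤ (so each ω_{ij_s, ia_s} ∈ H_{ī,n}). Let p_s ∈ 𝙿^{(n)}_{ij_s, ia_s} for each s and set π = ω(p₁)⋯ω(p_k) ∈ P_n. If π ∈ H_{ī,n} ∪ P_n⁺, then ω(p_s) ∈ H_{ī,n} for every s ∈ [1,k], and consequently for each s there exists g_s ∈ 𝙿^{(ī)}_{j_s, a_s} with ω(p_s) = Φ(ω(g_s)). -/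
/-- `p : {0,…,N+1} → ℤ` (modelled on `ℕ`) is a path in `𝙿^{(N)}_{i,a}`. -/
def IsPath (N i : ℕ) (a : ℤ) (p : ℕ → ℤ) : Prop :=
  p 0 = (i : ℤ) + a ∧ p (N + 1) = (N : ℤ) + 1 - i + a ∧
    ∀ r : ℕ, r ≤ N → (p (r + 1) - p r = 1 ∨ p (r + 1) - p r = -1)

/-- The weight `ω(p) = ∏_{r ∈ C_p⁺} ω_{r,p(r)} ∏_{r ∈ C_p⁻} ω_{r,p(r)}⁻¹` of a path,
as an element of the free abelian group `P_N` modelled additively on `(ℤ × ℤ) →₀ ℤ`. -/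
noncomputable def wt (N : ℕ) (p : ℕ → ℤ) : (ℤ × ℤ) →₀ ℤ :=
  (∑ r ∈ Finset.Icc 1 N,
      if p (r - 1) = p r + 1 ∧ p (r + 1) = p r + 1 then
        Finsupp.single ((r : ℤ), p r) 1 else 0)
  - ∑ r ∈ Finset.Icc 1 N,
      if p (r - 1) = p r - 1 ∧ p (r + 1) = p r - 1 then
        Finsupp.single ((r : ℤ), p r) 1 else 0

/-- Generator `ω_{j,c}` of `P_n` (written additively as `(ℤ × ℤ) →₀ ℤ`),
with the convention that `ω_{j,c} = 1` (i.e. `0`) for `j ∉ [1,n]`. -/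
noncomputable def og (N : ℕ) (j c : ℤ) : (ℤ × ℤ) →₀ ℤ :=
  if 1 ≤ j ∧ j ≤ (N : ℤ) then Finsupp.single (j, c) 1 else 0

/-- The subgroup `H_{ī,n}` of `P_n` generated by the
`ω_{ij,ia}` with `j ∈ [1,ī]`, `a ≤ 0` and `j - a` even. -/
noncomputable def Hsub (i ib : ℕ) : AddSubgroup ((ℤ × ℤ) →₀ ℤ) :=
  AddSubgroup.closure {x | ∃ (j : ℕ) (a : ℤ), 1 ≤ j ∧ j ≤ ib ∧ a ≤ 0 ∧
    Even ((j : ℤ) - a) ∧ x = Finsupp.single (((i * j : ℕ) : ℤ), (i : ℤ) * a) 1}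

/-- `P_n⁺`: the submonoid of `P_n` generated by the `ω_{j,c}` with `j ∈ [1,n]`, i.e.
the elements with nonnegative coefficients supported on indices in `[1,n]`. -/
def Pplus (N : ℕ) : Set ((ℤ × ℤ) →₀ ℤ) :=
  {f | ∀ x : ℤ × ℤ, 0 ≤ f x ∧ (f x ≠ 0 → 1 ≤ x.1 ∧ x.1 ≤ (N : ℤ))}

def PosC (p : ℕ → ℤ) (r : ℕ) : Prop := p (r - 1) = p r + 1 ∧ p (r + 1) = p r + 1
def NegC (p : ℕ → ℤ) (r : ℕ) : Prop := p (r - 1) = p r - 1 ∧ p (r + 1) = p r - 1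

def Good (i ib : ℕ) (r : ℕ) (c : ℤ) : Prop :=
  ∃ (j : ℕ) (a : ℤ), 1 ≤ j ∧ j ≤ ib ∧ a ≤ 0 ∧ Even ((j : ℤ) - a) ∧ r = i * j ∧ c = (i : ℤ) * a

lemma left_slope (N : ℕ) (p : ℕ → ℤ)
    (hs : ∀ r : ℕ, r ≤ N → (p (r + 1) - p r = 1 ∨ p (r + 1) - p r = -1)) :
    ∀ r : ℕ, r ≤ N → p r = p (r + 1) + 1 →
      p 0 = p (r + 1) + (r + 1) ∨
      ∃ r' : ℕ, 1 ≤ r' ∧ r' ≤ r ∧ p r' = p (r + 1) + (r + 1 - r') ∧ NegC p r' := by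
  intro r
  induction r with
  | zero => intro _ h; left; simpa using h
  | succ r ih =>
    intro hr h
    rcases hs r (by omega) with h1 | h1
    · right
      refine ⟨r + 1, by omega, le_refl _, ?_, ?_, ?_⟩
      · push_cast; linarith
      · simp only [Nat.add_sub_cancel]; linarith
      · linarith
    · rcases ih (by omega) (by linarith) with h2 | ⟨r', a1, a2, a3, a4⟩
      · left; push_cast; linarith
      · right; exact ⟨r', a1, by omega, by push_cast; linarith, a4⟩

lemma right_slope (N : ℕ) (p : ℕ → ℤ)
    (hs : ∀ r : ℕ, r ≤ N → (p (r + 1) - p r = 1 ∨ p (r + 1) - p r = -1)) :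
    ∀ d r : ℕ, r + d = N → p (r + 1) = p r + 1 →
      p (N + 1) = p r + (N + 1 - r) ∨
      ∃ r' : ℕ, r < r' ∧ r' ≤ N ∧ p r' = p r + (r' - r) ∧ NegC p r' := by
  intro d
  induction d with
  | zero =>
    intro r hr h; left
    have : r = N := by omega
    subst this; rw [h]; ring
  | succ d ih =>
    intro r hr h
    rcases hs (r + 1) (by omega) with h1 | h1
    · rcases ih (r + 1) (by omega) (by linarith) with h2 | ⟨r', a1, a2, a3, a4⟩
      · left; rw [h2]; push_cast; linarith
      · right; exact ⟨r', by omega, a2, by push_cast at a3; linarith, a4⟩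
    · right
      refine ⟨r + 1, by omega, by omega, ?_, ?_, ?_⟩
      · push_cast; linarith
      · simp only [Nat.add_sub_cancel]; linarith
      · linarith

lemma pos_good (i ib n : ℕ) (hi : 1 ≤ i) (hrel : n + 1 = i * (ib + 1)) (j : ℕ) (a : ℤ)
    (hja : a ≤ 0 ∧ Even ((j : ℤ) - a)) (p : ℕ → ℤ)
    (hp : IsPath n (i * j) ((i : ℤ) * a) p) (r : ℕ) (hr1 : 1 ≤ r) (hrn : r ≤ n)
    (hpos : PosC p r)
    (hneg : ∀ r', 1 ≤ r' → r' ≤ n → p r < p r' → NegC p r' → Good i ib r' (p r')) :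
    Good i ib r (p r) := by
  obtain ⟨h0, hN, hs⟩ := hp
  obtain ⟨ha, m, hm⟩ := hja
  have hi0 : (0 : ℤ) < i := by exact_mod_cast hi
  push_cast at h0 hN
  have hj : (j : ℤ) = a + 2 * m := by linarith
  have L : (∃ x : ℤ, p r + r = i * (2 * x)) ∧ (p r ≤ 0 ∨ p 0 = p r + r) := by
    obtain ⟨q, rfl⟩ : ∃ q, r = q + 1 := ⟨r - 1, by omega⟩
    have := hpos.1
    simp only [Nat.add_sub_cancel] at this
    rcases left_slope n p hs q (by omega) this with h | ⟨r', b1, b2, b3, b4⟩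
    · refine ⟨⟨a + m, ?_⟩, Or.inr (by rw [h]; push_cast; ring)⟩
      push_cast
      rw [← h, h0, hj]; ring
    · have hlt : p (q + 1) < p r' := by
        rw [b3]; have : (r' : ℤ) ≤ q := by exact_mod_cast b2
        linarith
      obtain ⟨j', a', c1, c2, c3, ⟨m', c4⟩, c5, c6⟩ := hneg r' b1 (by omega) hlt b4
      refine ⟨⟨a' + m', ?_⟩, Or.inl ?_⟩
      · have c7 : (r' : ℤ) = i * j' := by exact_mod_cast c5
        have c8 : (j' : ℤ) = a' + 2 * m' := by linarith
        rw [c8] at c7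
        push_cast
        linarith
      · have : (i : ℤ) * a' ≤ 0 := mul_nonpos_of_nonneg_of_nonpos hi0.le c3
        linarith
  have R : (∃ y : ℤ, p r - r = i * (2 * y)) ∧ (p r ≤ 0 ∨ p (n + 1) = p r + (n + 1 - r)) := by
    rcases right_slope n p hs (n - r) r (by omega) hpos.2 with h | ⟨r', b1, b2, b3, b4⟩
    · refine ⟨⟨-m, ?_⟩, Or.inr h⟩
      rw [hN, hj] at h
      linarith
    · have hlt : p r < p r' := by
        rw [b3]; have : (r : ℤ) < r' := by exact_mod_cast b1
        linarith
      obtain ⟨j', a', c1, c2, c3, ⟨m', c4⟩, c5, c6⟩ := hneg r' (by omega) b2 hlt b4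
      refine ⟨⟨-m', ?_⟩, Or.inl ?_⟩
      · have c7 : (r' : ℤ) = i * j' := by exact_mod_cast c5
        have c8 : (j' : ℤ) = a' + 2 * m' := by linarith
        rw [c8] at c7
        linarith
      · have : (i : ℤ) * a' ≤ 0 := mul_nonpos_of_nonneg_of_nonpos hi0.le c3
        linarith
  obtain ⟨⟨x, hx⟩, L2⟩ := L
  obtain ⟨⟨y, hy⟩, R2⟩ := R
  have hc0 : p r ≤ 0 := by
    rcases L2 with h | h
    · exact h
    rcases R2 with h' | h'
    · exact h'
    have : (i : ℤ) * a ≤ 0 := mul_nonpos_of_nonneg_of_nonpos hi0.le ha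
    linarith
  have hc : p r = i * (x + y) := by linarith
  have hr : (r : ℤ) = i * (x - y) := by linarith
  have hr1' : (1 : ℤ) ≤ r := by exact_mod_cast hr1
  have hxy : 0 < x - y := by
    by_contra hcon
    have : (i : ℤ) * (x - y) ≤ 0 := mul_nonpos_of_nonneg_of_nonpos hi0.le (by linarith)
    linarith
  have hxy2 : x - y < ib + 1 := by
    have : (i : ℤ) * (x - y) < i * (ib + 1) := by
      rw [← hr]
      have : (r : ℤ) < ((n + 1 : ℕ) : ℤ) := by exact_mod_cast Nat.lt_succ_of_le hrn
      rw [hrel] at this; exact_mod_cast this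
    exact lt_of_mul_lt_mul_left this hi0.le
  obtain ⟨J, hJ⟩ := Int.eq_ofNat_of_zero_le hxy.le
  refine ⟨J, x + y, by omega, by omega, ?_, ⟨-y, by linarith⟩, ?_, hc⟩
  · by_contra hcon
    have : 0 < (i : ℤ) * (x + y) := mul_pos hi0 (by linarith)
    linarith
  · rw [hJ] at hr; exact_mod_cast hr

open Classical in
lemma wt_apply (N : ℕ) (p : ℕ → ℤ) (r : ℕ) (hr1 : 1 ≤ r) (hrn : r ≤ N) (c : ℤ) :
    wt N p ((r : ℤ), c) =
      (if PosC p r ∧ p r = c then 1 else 0) - (if NegC p r ∧ p r = c then 1 else 0) := by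
  unfold wt
  rw [Finsupp.sub_apply, Finsupp.finsetSum_apply, Finsupp.finsetSum_apply]
  have hm : r ∈ Finset.Icc 1 N := Finset.mem_Icc.2 ⟨hr1, hrn⟩
  rw [Finset.sum_eq_single_of_mem r hm, Finset.sum_eq_single_of_mem r hm]
  · congr 1
    · by_cases h : p (r - 1) = p r + 1 ∧ p (r + 1) = p r + 1
      · simp [PosC, h, Finsupp.single_apply]
      · rw [if_neg h, if_neg (fun h' => h h'.1)]; rfl
    · by_cases h : p (r - 1) = p r - 1 ∧ p (r + 1) = p r - 1
      · simp [NegC, h, Finsupp.single_apply]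
      · rw [if_neg h, if_neg (fun h' => h h'.1)]; rfl
  · intro b _ hb
    split_ifs
    · rw [Finsupp.single_apply, if_neg]; simp [hb]
    · rfl
  · intro b _ hb
    split_ifs
    · rw [Finsupp.single_apply, if_neg]; simp [hb]
    · rfl

lemma H_apply (i ib : ℕ) (f : (ℤ × ℤ) →₀ ℤ) (hf : f ∈ Hsub i ib) (r : ℕ) (c : ℤ)
    (hb : ¬ Good i ib r c) : f ((r : ℤ), c) = 0 := by
  unfold Hsub at hf
  induction hf using AddSubgroup.closure_induction with
  | mem x hx =>
    obtain ⟨j, a, h1, h2, h3, h4, rfl⟩ := hx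
    rw [Finsupp.single_apply, if_neg]
    intro h
    rw [Prod.mk.injEq] at h
    exact hb ⟨j, a, h1, h2, h3, h4, by exact_mod_cast h.1.symm, h.2.symm⟩
  | zero => rfl
  | add x y _ _ hx hy => rw [Finsupp.add_apply, hx, hy]; rfl
  | neg x _ hx => rw [Finsupp.neg_apply, hx]; rfl

lemma wt_mem (i ib n : ℕ) (p : ℕ → ℤ)
    (hP : ∀ r, 1 ≤ r → r ≤ n → PosC p r → Good i ib r (p r))
    (hM : ∀ r, 1 ≤ r → r ≤ n → NegC p r → Good i ib r (p r)) : wt n p ∈ Hsub i ib := by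
  have key : ∀ r c, Good i ib r c → Finsupp.single ((r : ℤ), c) (1 : ℤ) ∈ Hsub i ib := by
    rintro r c ⟨j, a, h1, h2, h3, h4, rfl, rfl⟩
    exact AddSubgroup.subset_closure ⟨j, a, h1, h2, h3, h4, rfl⟩
  unfold wt
  refine sub_mem (sum_mem ?_) (sum_mem ?_)
  · intro r hr
    rw [Finset.mem_Icc] at hr
    split_ifs with h
    · exact key _ _ (hP r hr.1 hr.2 h)
    · exact zero_mem _
  · intro r hr
    rw [Finset.mem_Icc] at hr
    split_ifs with h
    · exact key _ _ (hM r hr.1 hr.2 h)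
    · exact zero_mem _

lemma block (i : ℕ) (hi : 1 ≤ i) (n b : ℕ) (p : ℕ → ℤ)
    (hs : ∀ r : ℕ, r ≤ n → (p (r + 1) - p r = 1 ∨ p (r + 1) - p r = -1))
    (hb : i * (b + 1) ≤ n + 1)
    (hnc : ∀ r, 1 ≤ r → r ≤ n → ¬ i ∣ r → ¬ PosC p r ∧ ¬ NegC p r) :
    ∃ e : ℤ, (e = 1 ∨ e = -1) ∧ ∀ t, t ≤ i → p (i * b + t) = p (i * b) + e * t := by
  have hb' : i * b + i ≤ n + 1 := by rw [← Nat.mul_succ]; exact hb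
  refine ⟨p (i * b + 1) - p (i * b), hs _ (by omega), ?_⟩
  have main : ∀ t, t + 1 ≤ i → p (i * b + t + 1) - p (i * b + t) = p (i * b + 1) - p (i * b) := by
    intro t
    induction t with
    | zero => intro _; rfl
    | succ t ih =>
      intro ht
      have ih' := ih (by omega)
      have hnd : ¬ i ∣ i * b + t + 1 := by
        rw [add_assoc, Nat.dvd_add_right (dvd_mul_right _ _)]
        intro h; have := Nat.le_of_dvd (by omega) h; omega
      obtain ⟨h1, h2⟩ := hnc (i * b + t + 1) (by omega) (by omega) hnd
      unfold PosC at h1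
      unfold NegC at h2
      simp only [Nat.add_sub_cancel] at h1 h2
      have s1 := hs (i * b + t) (by omega)
      have s2 := hs (i * b + t + 1) (by omega)
      rw [← add_assoc]
      omega
  intro t
  induction t with
  | zero => intro _; simp
  | succ t ih =>
    intro ht
    have := main t ht
    have := ih (by omega)
    rw [← add_assoc]; push_cast
    linarith

lemma sum_mul (i ib n : ℕ) (hi : 1 ≤ i) (hrel : n + 1 = i * (ib + 1))
    (F : ℕ → (ℤ × ℤ) →₀ ℤ) (hF : ∀ r, 1 ≤ r → r ≤ n → ¬ i ∣ r → F r = 0) :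
    ∑ r ∈ Finset.Icc 1 n, F r = ∑ r ∈ Finset.Icc 1 ib, F (i * r) := by
  have hinj : Set.InjOn (fun r => i * r) (Finset.Icc 1 ib : Finset ℕ) := by
    intro x _ y _ h; exact Nat.eq_of_mul_eq_mul_left hi h
  rw [← Finset.sum_image (f := F) hinj]
  symm
  apply Finset.sum_subset
  · intro r hr
    obtain ⟨q, hq, rfl⟩ := Finset.mem_image.1 hr
    rw [Finset.mem_Icc] at hq ⊢
    constructor
    · exact Nat.mul_pos hi hq.1
    · have : i * q ≤ i * ib := Nat.mul_le_mul_left _ hq.2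
      rw [Nat.mul_succ] at hrel
      show i * q ≤ n
      omega
  · intro r hr hr'
    rw [Finset.mem_Icc] at hr
    apply hF r hr.1 hr.2
    rintro ⟨q, rfl⟩
    apply hr'
    refine Finset.mem_image.2 ⟨q, Finset.mem_Icc.2 ⟨?_, ?_⟩, rfl⟩
    · exact Nat.pos_of_mul_pos_left hr.1
    · have : i * q < i * (ib + 1) := by omega
      exact Nat.le_of_lt_succ (lt_of_mul_lt_mul_left this (Nat.zero_le _))

lemma exists_g (i ib n : ℕ) (hi : 1 ≤ i) (hrel : n + 1 = i * (ib + 1)) (j : ℕ) (a : ℤ)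
    (p : ℕ → ℤ) (hp : IsPath n (i * j) ((i : ℤ) * a) p)
    (hP : ∀ r, 1 ≤ r → r ≤ n → PosC p r → Good i ib r (p r))
    (hM : ∀ r, 1 ≤ r → r ≤ n → NegC p r → Good i ib r (p r))
    (Φ : ((ℤ × ℤ) →₀ ℤ) →+ ((ℤ × ℤ) →₀ ℤ))
    (hΦ : ∀ (j : ℕ) (c : ℤ), 1 ≤ j → j ≤ ib →
      Φ (Finsupp.single ((j : ℤ), c) 1) = Finsupp.single (((i * j : ℕ) : ℤ), (i : ℤ) * c) 1) :
    ∃ g : ℕ → ℤ, IsPath ib j a g ∧ wt n p = Φ (wt ib g) := by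
  obtain ⟨h0, hN, hs⟩ := hp
  have hi0 : (0 : ℤ) < i := by exact_mod_cast hi
  have hnc : ∀ r, 1 ≤ r → r ≤ n → ¬ i ∣ r → ¬ PosC p r ∧ ¬ NegC p r := by
    intro r h1 h2 h3
    constructor
    · intro h
      obtain ⟨j, a, _, _, _, _, h5, _⟩ := hP r h1 h2 h
      exact h3 ⟨j, h5⟩
    · intro h
      obtain ⟨j, a, _, _, _, _, h5, _⟩ := hM r h1 h2 h
      exact h3 ⟨j, h5⟩
  have hblk : ∀ b, b ≤ ib → ∃ e : ℤ, (e = 1 ∨ e = -1) ∧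
      ∀ t, t ≤ i → p (i * b + t) = p (i * b) + e * t := by
    intro b hb
    refine block i hi n b p hs ?_ hnc
    rw [hrel]; exact Nat.mul_le_mul_left _ (by omega)
  have hdiv : ∀ b, b ≤ ib + 1 → (i : ℤ) ∣ p (i * b) := by
    intro b
    induction b with
    | zero =>
      intro _; refine ⟨j + a, ?_⟩
      rw [mul_zero, h0]; push_cast; ring
    | succ b ih =>
      intro hb
      obtain ⟨e, _, he⟩ := hblk b (by omega)
      rw [Nat.mul_succ, he i le_rfl]
      exact dvd_add (ih (by omega)) (dvd_mul_left _ _)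
  let g : ℕ → ℤ := fun b => p (i * b) / i
  have hg : ∀ b, b ≤ ib + 1 → p (i * b) = i * g b := by
    intro b hb
    exact (Int.mul_ediv_cancel' (hdiv b hb)).symm
  have hstep : ∀ b, b ≤ ib → (p (i * b + 1) - p (i * b) = g (b + 1) - g b ∧
      p (i * (b + 1)) - p (i * (b + 1) - 1) = g (b + 1) - g b) ∧
      (g (b + 1) - g b = 1 ∨ g (b + 1) - g b = -1) := by
    intro b hb
    obtain ⟨e, he1, he⟩ := hblk b hb
    have e1 := he 1 hi
    have e2 := he i le_rfl
    have e3 := he (i - 1) (by omega)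
    have e4 : i * (b + 1) - 1 = i * b + (i - 1) := by rw [Nat.mul_succ]; omega
    have e5 : g (b + 1) - g b = e := by
      have q1 := hg (b + 1) (by omega)
      have q2 := hg b (by omega)
      rw [Nat.mul_succ] at q1
      have : (i : ℤ) * (g (b + 1) - g b) = i * e := by linarith
      exact mul_left_cancel₀ hi0.ne' this
    rw [e5, e4, Nat.mul_succ, e1, e2, e3]
    refine ⟨⟨by push_cast; ring, ?_⟩, he1⟩
    push_cast [Nat.cast_sub hi]; ring
  have hcor : ∀ b, 1 ≤ b → b ≤ ib → (PosC p (i * b) ↔ PosC g b) ∧ (NegC p (i * b) ↔ NegC g b) := by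
    intro b hb1 hb
    obtain ⟨c, rfl⟩ : ∃ c, b = c + 1 := ⟨b - 1, by omega⟩
    have q1 := (hstep c (by omega)).1.2
    have q2 := (hstep (c + 1) hb).1.1
    unfold PosC NegC
    simp only [Nat.add_sub_cancel]
    constructor <;> constructor <;> rintro ⟨z1, z2⟩ <;> constructor <;> linarith
  refine ⟨g, ⟨?_, ?_, fun b hb => (hstep b hb).2⟩, ?_⟩
  · have := hg 0 (by omega)
    rw [mul_zero, h0] at this
    push_cast at this
    apply mul_left_cancel₀ hi0.ne'
    linarith
  · have := hg (ib + 1) le_rfl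
    have hr : (n : ℤ) + 1 = i * (ib + 1) := by exact_mod_cast hrel
    rw [← hrel, hN, hr] at this
    push_cast at this
    apply mul_left_cancel₀ hi0.ne'
    linarith
  · unfold wt
    rw [map_sub, map_sum, map_sum, sum_mul i ib n hi hrel, sum_mul i ib n hi hrel]
    · congr 1
      · apply Finset.sum_congr rfl
        intro b hb
        rw [Finset.mem_Icc] at hb
        have hc := (hcor b hb.1 hb.2).1
        unfold PosC at hc
        by_cases h : g (b - 1) = g b + 1 ∧ g (b + 1) = g b + 1
        · rw [if_pos h, if_pos (hc.2 h), hΦ b _ hb.1 hb.2, hg b (by omega)]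
        · rw [if_neg h, if_neg (fun h' => h (hc.1 h')), map_zero]
      · apply Finset.sum_congr rfl
        intro b hb
        rw [Finset.mem_Icc] at hb
        have hc := (hcor b hb.1 hb.2).2
        unfold NegC at hc
        by_cases h : g (b - 1) = g b - 1 ∧ g (b + 1) = g b - 1
        · rw [if_pos h, if_pos (hc.2 h), hΦ b _ hb.1 hb.2, hg b (by omega)]
        · rw [if_neg h, if_neg (fun h' => h (hc.1 h')), map_zero]
    · intro r h1 h2 h3
      exact if_neg (hnc r h1 h2 h3).2
    · intro r h1 h2 h3
      exact if_neg (hnc r h1 h2 h3).1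

theorem stmt17 (i ib n : ℕ) (hi : 1 ≤ i) (hib : 1 ≤ ib) (hn : 1 ≤ n)
    (hrel : n + 1 = i * (ib + 1))
    (k : ℕ) (hk : 1 ≤ k) (idx : ℕ → ℕ) (a : ℕ → ℤ)
    (hidx : ∀ s : ℕ, 1 ≤ s → s ≤ k → 1 ≤ idx s ∧ idx s ≤ ib)
    (ha : ∀ s : ℕ, 1 ≤ s → s ≤ k → a s ≤ 0 ∧ Even ((idx s : ℤ) - a s))
    (p : ℕ → ℕ → ℤ)
    (hp : ∀ s : ℕ, 1 ≤ s → s ≤ k → IsPath n (i * idx s) ((i : ℤ) * a s) (p s))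
    (Φ : ((ℤ × ℤ) →₀ ℤ) →+ ((ℤ × ℤ) →₀ ℤ))
    (hΦ : ∀ (j : ℕ) (c : ℤ), 1 ≤ j → j ≤ ib →
      Φ (Finsupp.single ((j : ℤ), c) 1) = Finsupp.single (((i * j : ℕ) : ℤ), (i : ℤ) * c) 1)
    (hmem : (∑ s ∈ Finset.Icc 1 k, wt n (p s)) ∈ (↑(Hsub i ib) ∪ Pplus n : Set _)) :
    ∀ s : ℕ, 1 ≤ s → s ≤ k →
      wt n (p s) ∈ Hsub i ib ∧
      ∃ g : ℕ → ℤ, IsPath ib (idx s) (a s) g ∧ wt n (p s) = Φ (wt ib g) := by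
  classical
  have hM : ∀ s, 1 ≤ s → s ≤ k → ∀ r, 1 ≤ r → r ≤ n → NegC (p s) r → Good i ib r (p s r) := by
    by_contra hcon
    push Not at hcon
    obtain ⟨s0, hs1, hsk, r0, hr1, hrn, hneg0, hbad0⟩ := hcon
    let B := ((Finset.Icc 1 k) ×ˢ (Finset.Icc 1 n)).filter
      (fun x => NegC (p x.1) x.2 ∧ ¬ Good i ib x.2 (p x.1 x.2))
    have hB : ∀ s r, (s, r) ∈ B ↔ ((1 ≤ s ∧ s ≤ k) ∧ (1 ≤ r ∧ r ≤ n)) ∧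
        NegC (p s) r ∧ ¬ Good i ib r (p s r) := by
      intro s r
      simp only [B, Finset.mem_filter, Finset.mem_product, Finset.mem_Icc]
    have hne : B.Nonempty := ⟨(s0, r0), (hB _ _).2 ⟨⟨⟨hs1, hsk⟩, hr1, hrn⟩, hneg0, hbad0⟩⟩
    obtain ⟨⟨s, r⟩, hsr, hmax⟩ := Finset.exists_max_image B (fun x => p x.1 x.2) hne
    obtain ⟨⟨⟨h1, h2⟩, h3, h4⟩, hneg, hbad⟩ := (hB s r).1 hsr
    have hsum : 0 ≤ ∑ t ∈ Finset.Icc 1 k, wt n (p t) ((r : ℤ), p s r) := by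
      rw [← Finsupp.finsetSum_apply]
      rcases hmem with h | h
      · exact (H_apply i ib _ h r _ hbad).ge
      · exact (h _).1
    have hterm : wt n (p s) ((r : ℤ), p s r) < 0 := by
      have hnp : ¬ (PosC (p s) r ∧ p s r = p s r) := by
        rintro ⟨⟨z, _⟩, _⟩
        have := hneg.1
        omega
      rw [wt_apply n _ r h3 h4, if_neg hnp, if_pos ⟨hneg, rfl⟩]
      norm_num
    obtain ⟨t, ht, htpos⟩ : ∃ t ∈ Finset.Icc 1 k, 0 < wt n (p t) ((r : ℤ), p s r) := by
      by_contra hc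
      push Not at hc
      have := Finset.sum_lt_sum (s := Finset.Icc 1 k)
        (f := fun t => wt n (p t) ((r : ℤ), p s r)) (g := fun _ => 0) hc
        ⟨s, Finset.mem_Icc.2 ⟨h1, h2⟩, hterm⟩
      rw [Finset.sum_const_zero] at this
      exact absurd hsum (not_le.2 this)
    rw [Finset.mem_Icc] at ht
    have hpos : PosC (p t) r ∧ p t r = p s r := by
      by_contra hc
      rw [wt_apply n _ r h3 h4, if_neg hc] at htpos
      split_ifs at htpos <;> omega
    apply hbad
    rw [← hpos.2]
    refine pos_good i ib n hi hrel (idx t) (a t) (ha t ht.1 ht.2) (p t) (hp t ht.1 ht.2) r h3 h4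
      hpos.1 ?_
    intro r' g1 g2 g3 g4
    by_contra hb'
    have := hmax (t, r') ((hB t r').2 ⟨⟨ht, g1, g2⟩, g4, hb'⟩)
    have e := hpos.2
    simp only at this
    omega
  intro s h1 h2
  have hP : ∀ r, 1 ≤ r → r ≤ n → PosC (p s) r → Good i ib r (p s r) := by
    intro r g1 g2 g3
    exact pos_good i ib n hi hrel (idx s) (a s) (ha s h1 h2) (p s) (hp s h1 h2) r g1 g2 g3
      (fun r' e1 e2 _ e4 => hM s h1 h2 r' e1 e2 e4)
  exact ⟨wt_mem i ib n (p s) hP (hM s h1 h2),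
    exists_g i ib n hi hrel (idx s) (a s) (p s) (hp s h1 h2) hP (hM s h1 h2) Φ hΦ⟩
end
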